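/- arXiv:2410.11349 — 3 statements merged into one kernel-verified Lean document; each statement's English description precedes it below -/
import Mathlib

section
/- Let Ω be a complete separable metric space and let Ê be a real-valued functional on the space C_{b.Lip}(Ω) of bounded Lipschitz functions on Ω satisfying: (i) monotonicity (X ≤ Y pointwise implies Ê[X] ≤ Ê[Y]); (ii) constant preserving (Ê[c] = c for every constant c ∈ ℝ); (iii) subadditivity (Ê[X + Y] ≤ Ê[X] + Ê[Y]); (iv) positive homogeneity (Ê[λX] = λÊ[X] for every λ ≥ 0); (v) regularity (if X_n ↓ 0 pointwise then Ê[X_n] ↓ 0). Then there exists a convex set 𝒫 of Borel probability measures on Ω, compact in the topology of weak convergence of measures, such that Ê[X] = sup_{P ∈ 𝒫} ∫_Ω X dP for every X ∈ C_{b.Lip}(Ω). -/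
open MeasureTheory Set
open scoped NNReal ENNReal RealInnerProductSpace

noncomputable section

/-- Bounded Lipschitz real-valued function on a (pseudo)metric space. -/
def IsBLip {α : Type*} [PseudoMetricSpace α] (ψ : α → ℝ) : Prop :=
  (∃ K : ℝ≥0, LipschitzWith K ψ) ∧ ∃ C : ℝ, ∀ x, |ψ x| ≤ C

variable {Ω : Type*} [MeasurableSpace Ω] [TopologicalSpace Ω]

/-- The sublinear expectation `Ê[f] = sup_{P ∈ Pset} E_P[f]`. -/
def hatE (Pset : Set (ProbabilityMeasure Ω)) (f : Ω → ℝ) : ℝ :=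
  ⨆ P : Pset, ∫ ω, f ω ∂((P : ProbabilityMeasure Ω) : Measure Ω)

/-- Convexity of a set of probability measures. -/
def ConvexPM (Pset : Set (ProbabilityMeasure Ω)) : Prop :=
  ∀ P ∈ Pset, ∀ Q ∈ Pset, ∀ a : ℝ≥0, a ≤ 1 →
    ∃ R ∈ Pset, (R : Measure Ω)
      = (a : ℝ≥0∞) • (P : Measure Ω) + ((1 - a : ℝ≥0) : ℝ≥0∞) • (Q : Measure Ω)

/-- `σ(X_1, …, X_i)` for a finite family of `ℝ^d`-valued maps (0-indexed:
`F X i` is generated by `X 0, …, X (i-1)`; `F X 0` is trivial). -/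
def sigmaF {d n : ℕ} (X : Fin n → Ω → EuclideanSpace ℝ (Fin d)) (i : ℕ) :
    MeasurableSpace Ω :=
  ⨆ j : Fin n, ⨆ _ : (j : ℕ) < i, MeasurableSpace.comap (X j) (borel _)

/-- Independence of `X_1, …, X_n` (0-indexed) under the sublinear expectation
associated with `Pset`. -/
def IndepUnder (Pset : Set (ProbabilityMeasure Ω)) {d n : ℕ}
    (X : Fin n → Ω → EuclideanSpace ℝ (Fin d)) : Prop :=
  ∀ (i : ℕ) (hi : i + 1 < n)
    (ψ : ((Fin (i + 1) → EuclideanSpace ℝ (Fin d)) × EuclideanSpace ℝ (Fin d)) → ℝ),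
    IsBLip ψ →
    hatE Pset (fun ω => ψ ((fun j => X ⟨j.1, lt_trans j.2 hi⟩ ω), X ⟨i + 1, hi⟩ ω))
      = hatE Pset (fun ω =>
          hatE Pset (fun ω' => ψ ((fun j => X ⟨j.1, lt_trans j.2 hi⟩ ω), X ⟨i + 1, hi⟩ ω')))

/-- Uniformly bounded second moments over `Pset`. -/
def HasBddMoment2 (Pset : Set (ProbabilityMeasure Ω)) {d : ℕ}
    (X : Ω → EuclideanSpace ℝ (Fin d)) : Prop :=
  ∃ C : ℝ, ∀ P ∈ Pset, Integrable (fun ω => ‖X ω‖ ^ 2) (P : Measure Ω) ∧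
    ∫ ω, ‖X ω‖ ^ 2 ∂(P : Measure Ω) ≤ C

/-- `Θ_X = {θ : ⟨θ, p⟩ ≤ Ê[⟨p, X⟩] for all p}`. -/
def ThetaSet (Pset : Set (ProbabilityMeasure Ω)) {d : ℕ}
    (X : Ω → EuclideanSpace ℝ (Fin d)) : Set (EuclideanSpace ℝ (Fin d)) :=
  {θ | ∀ p : EuclideanSpace ℝ (Fin d), ⟪θ, p⟫ ≤ hatE Pset (fun ω => ⟪p, X ω⟫)}

namespace IsBLip

variable {α : Type*} [PseudoMetricSpace α] {f g : α → ℝ}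

theorem const (c : ℝ) : IsBLip (fun _ : α => c) :=
  ⟨⟨0, LipschitzWith.const c⟩, |c|, fun _ => le_rfl⟩

theorem add (hf : IsBLip f) (hg : IsBLip g) : IsBLip (fun x => f x + g x) := by
  obtain ⟨⟨K, hK⟩, C, hC⟩ := hf
  obtain ⟨⟨K', hK'⟩, C', hC'⟩ := hg
  exact ⟨⟨K + K', hK.add hK'⟩, C + C',
    fun x => (abs_add_le _ _).trans (add_le_add (hC x) (hC' x))⟩

theorem mul (hf : IsBLip f) (hg : IsBLip g) : IsBLip (fun x => f x * g x) := by
  obtain ⟨⟨K, hK⟩, C, hC⟩ := hf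
  obtain ⟨⟨K', hK'⟩, C', hC'⟩ := hg
  replace hC := fun x => (hC x).trans (le_abs_self C)
  replace hC' := fun x => (hC' x).trans (le_abs_self C')
  refine ⟨⟨(|C| * K' + |C'| * K).toNNReal, LipschitzWith.of_dist_le_mul fun x y => ?_⟩,
    |C| * |C'|, fun x => ?_⟩
  · have h1 := hK.dist_le_mul x y
    have h2 := hK'.dist_le_mul x y
    rw [Real.coe_toNNReal _ (by positivity)]
    rw [Real.dist_eq] at *
    calc |f x * g x - f y * g y| = |f x * (g x - g y) + (f x - f y) * g y| := by
          congr 1; ring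
      _ ≤ |f x| * |g x - g y| + |f x - f y| * |g y| := by
          rw [← abs_mul, ← abs_mul]; exact abs_add_le _ _
      _ ≤ |C| * (K' * dist x y) + (K * dist x y) * |C'| :=
          add_le_add (mul_le_mul (hC x) h2 (abs_nonneg _) (abs_nonneg _))
            (mul_le_mul h1 (hC' y) (abs_nonneg _) (by positivity))
      _ = _ := by ring
  · rw [abs_mul]
    exact mul_le_mul (hC x) (hC' x) (abs_nonneg _) (abs_nonneg _)

theorem lipschitz_comp {K : ℝ≥0} {φ : ℝ → ℝ} (hφ : LipschitzWith K φ) (hf : IsBLip f) :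
    IsBLip (fun x => φ (f x)) := by
  obtain ⟨⟨K', hK'⟩, C, hC⟩ := hf
  refine ⟨⟨K * K', hφ.comp hK'⟩, |φ 0| + K * C, fun x => ?_⟩
  have h1 := hφ.dist_le_mul (f x) 0
  rw [Real.dist_eq, Real.dist_eq, sub_zero] at h1
  have h2 : |φ (f x)| ≤ |φ 0| + |φ (f x) - φ 0| := by
    simpa using abs_add_le (φ 0) (φ (f x) - φ 0)
  have h3 : (K : ℝ) * |f x| ≤ K * C := by gcongr; exact hC x
  linarith

theorem continuous (hf : IsBLip f) : Continuous f :=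
  hf.1.choose_spec.continuous

theorem integrable [MeasurableSpace α] [OpensMeasurableSpace α] (hf : IsBLip f)
    (μ : Measure α) [IsFiniteMeasure μ] : Integrable f μ := by
  obtain ⟨C, hC⟩ := hf.2
  exact Integrable.of_bound hf.continuous.measurable.aestronglyMeasurable C
    (Filter.Eventually.of_forall hC)

end IsBLip

/-- The algebra of bounded Lipschitz functions. -/
def bLip (α : Type*) [PseudoMetricSpace α] : Subalgebra ℝ (α → ℝ) where
  carrier := {f | IsBLip f}
  mul_mem' hf hg := hf.mul hg
  add_mem' hf hg := hf.add hg
  algebraMap_mem' c := IsBLip.const c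

namespace bLip

section Clamp

variable {α : Type*} [PseudoMetricSpace α]

/-- Truncation of a bounded Lipschitz function to values in `[0, 1]`. -/
def clamp (f : bLip α) : bLip α :=
  ⟨fun x => max (min (f.1 x) 1) 0,
    f.2.lipschitz_comp ((LipschitzWith.id.min_const 1).max_const 0)⟩

theorem clamp_apply (f : bLip α) (x : α) : (clamp f).1 x = max (min (f.1 x) 1) 0 := rfl

theorem sum_apply {ι : Type*} (s : Finset ι) (f : ι → bLip α) (x : α) :
    (∑ i ∈ s, f i).1 x = ∑ i ∈ s, (f i).1 x := by
  have h : (∑ i ∈ s, f i).1 = ∑ i ∈ s, (f i).1 := AddSubmonoidClass.coe_finsetSum f s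
  rw [h, Finset.sum_apply]

end Clamp

section Daniell

variable {α : Type*} [PseudoMetricSpace α] (L : bLip α →ₗ[ℝ] ℝ)

/-- The infimum of `L f` over the nonnegative `f` that are at least `1` on `A`. -/
def preContent (A : Set α) : ℝ≥0∞ :=
  ⨅ (f : bLip α) (_ : (∀ x, 0 ≤ f.1 x) ∧ ∀ x ∈ A, 1 ≤ f.1 x), ENNReal.ofReal (L f)

theorem preContent_le {A : Set α} {f : bLip α} (h0 : ∀ x, 0 ≤ f.1 x) (h1 : ∀ x ∈ A, 1 ≤ f.1 x) :
    preContent L A ≤ ENNReal.ofReal (L f) :=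
  iInf₂_le f ⟨h0, h1⟩

theorem preContent_empty : preContent L ∅ = 0 := by
  have h := preContent_le L (A := ∅) (f := 0) (fun _ => le_rfl) (by simp)
  simpa using h

theorem preContent_lt_top (A : Set α) : preContent L A < ∞ :=
  (preContent_le L (f := 1) (fun _ => zero_le_one) (fun _ _ => le_rfl)).trans_lt
    ENNReal.ofReal_lt_top

/-- The outer measure induced by a functional on the bounded Lipschitz functions. -/
def outer : OuterMeasure α := OuterMeasure.ofFunction (preContent L) (preContent_empty L)

variable {L}

theorem outer_le_tsum {A : Set α} {f : ℕ → bLip α} (h0 : ∀ n x, 0 ≤ (f n).1 x)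
    (h1 : ∀ x ∈ A, ∃ n, 1 ≤ (f n).1 x) : outer L A ≤ ∑' n, ENNReal.ofReal (L (f n)) := by
  rw [outer, OuterMeasure.ofFunction_apply]
  refine (iInf₂_le (fun n => {x | 1 ≤ (f n).1 x}) fun x hx => mem_iUnion.2 (h1 x hx)).trans ?_
  exact ENNReal.tsum_le_tsum fun n => preContent_le L (h0 n) fun x hx => hx

theorem outer_le {A : Set α} {f : bLip α} (h0 : ∀ x, 0 ≤ f.1 x) (h1 : ∀ x ∈ A, 1 ≤ f.1 x) :
    outer L A ≤ ENNReal.ofReal (L f) :=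
  (OuterMeasure.ofFunction_le A).trans (preContent_le L h0 h1)

theorem exists_tsum_le_outer_add (A : Set α) {ε : ℝ≥0} (hε : 0 < ε) :
    ∃ f : ℕ → bLip α, (∀ n x, 0 ≤ (f n).1 x) ∧ (∀ x ∈ A, ∃ n, 1 ≤ (f n).1 x) ∧
      ∑' n, ENNReal.ofReal (L (f n)) ≤ outer L A + ε := by
  have hfin : outer L A ≠ ∞ :=
    ((OuterMeasure.ofFunction_le A).trans_lt (preContent_lt_top L A)).ne
  have hlt : outer L A < outer L A + (ε / 2 : ℝ≥0) :=
    ENNReal.lt_add_right hfin (by simpa using hε.ne')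
  nth_rewrite 1 [outer] at hlt
  rw [OuterMeasure.ofFunction_apply] at hlt
  simp only [iInf_lt_iff] at hlt
  obtain ⟨t, hAt, ht⟩ := hlt
  obtain ⟨δ, hδ, hδsum⟩ := ENNReal.exists_pos_sum_of_countable
    (ε := ((ε / 2 : ℝ≥0) : ℝ≥0∞)) (by simpa using hε.ne') ℕ
  have key : ∀ n, ∃ f : bLip α, ((∀ x, 0 ≤ f.1 x) ∧ ∀ x ∈ t n, 1 ≤ f.1 x) ∧
      ENNReal.ofReal (L f) < preContent L (t n) + δ n := by
    intro n
    have h : preContent L (t n) < preContent L (t n) + δ n :=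
      ENNReal.lt_add_right (preContent_lt_top L _).ne (by simpa using (hδ n).ne')
    nth_rewrite 1 [preContent] at h
    simpa only [iInf_lt_iff, exists_prop] using h
  choose f hf hfl using key
  refine ⟨f, fun n => (hf n).1, fun x hx => ?_, ?_⟩
  · obtain ⟨n, hn⟩ := mem_iUnion.1 (hAt hx)
    exact ⟨n, (hf n).2 x hn⟩
  · calc ∑' n, ENNReal.ofReal (L (f n)) ≤ ∑' n, (preContent L (t n) + δ n) :=
          ENNReal.tsum_le_tsum fun n => (hfl n).le
      _ = ∑' n, preContent L (t n) + ∑' n, (δ n : ℝ≥0∞) := ENNReal.tsum_add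
      _ ≤ (outer L A + (ε / 2 : ℝ≥0)) + (ε / 2 : ℝ≥0) := add_le_add ht.le hδsum.le
      _ = outer L A + ε := by
          rw [add_assoc, ← ENNReal.coe_add, add_halves]

theorem exists_separating {s t : Set α} (h : Metric.AreSeparated s t) :
    ∃ g : bLip α, (∀ x, 0 ≤ g.1 x) ∧ (∀ x, g.1 x ≤ 1) ∧ (∀ x ∈ s, g.1 x = 1) ∧
      ∀ x ∈ t, g.1 x = 0 := by
  obtain ⟨r, hr, hst⟩ := h
  set δ : ℝ := (min r 1).toReal with hδ
  have hne : min r 1 ≠ ∞ := ne_top_of_le_ne_top ENNReal.one_ne_top (min_le_right _ _)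
  have hpos : 0 < δ := ENNReal.toReal_pos (by simp [hr]) hne
  have hlip := lipschitzWith_thickenedIndicator hpos s
  refine ⟨⟨fun x => (thickenedIndicator hpos s x : ℝ), ⟨_, fun x y => hlip x y⟩, 1, fun x => ?_⟩,
    fun x => NNReal.coe_nonneg _, fun x => ?_, fun x hx => ?_, fun x hx => ?_⟩
  · rw [abs_of_nonneg (NNReal.coe_nonneg _)]
    exact_mod_cast thickenedIndicator_le_one hpos s x
  · exact_mod_cast thickenedIndicator_le_one hpos s x
  · change (thickenedIndicator hpos s x : ℝ) = 1
    rw [thickenedIndicator_one hpos s hx, NNReal.coe_one]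
  · change (thickenedIndicator hpos s x : ℝ) = 0
    rw [thickenedIndicator_zero hpos s, NNReal.coe_zero]
    rw [Metric.thickening, mem_ofPred_eq, not_lt, hδ, ENNReal.ofReal_toReal hne]
    refine Metric.le_infEDist.2 fun y hy => (min_le_left _ _).trans ?_
    rw [edist_comm]
    exact hst y hy x hx

theorem nonneg_mul {f g : bLip α} (hf : ∀ x, 0 ≤ f.1 x) (hg : ∀ x, 0 ≤ g.1 x) (x : α) :
    0 ≤ (f * g).1 x := mul_nonneg (hf x) (hg x)

theorem outer_add_le (hpos : ∀ f : bLip α, (∀ x, 0 ≤ f.1 x) → 0 ≤ L f) {s t : Set α}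
    (h : Metric.AreSeparated s t) : outer L s + outer L t ≤ outer L (s ∪ t) := by
  obtain ⟨g, g0, g1, gs, gt⟩ := exists_separating h
  have g0' : ∀ x, 0 ≤ (1 - g).1 x := fun x => sub_nonneg.2 (g1 x)
  refine ENNReal.le_of_forall_pos_le_add fun ε hε _ => ?_
  obtain ⟨f, f0, f1, hf⟩ := exists_tsum_le_outer_add (L := L) (s ∪ t) hε
  refine le_trans ?_ hf
  have hs : outer L s ≤ ∑' n, ENNReal.ofReal (L (g * f n)) := by
    refine outer_le_tsum (fun n => nonneg_mul g0 (f0 n)) fun x hx => ?_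
    obtain ⟨n, hn⟩ := f1 x (Or.inl hx)
    exact ⟨n, by change 1 ≤ g.1 x * (f n).1 x; rwa [gs x hx, one_mul]⟩
  have ht : outer L t ≤ ∑' n, ENNReal.ofReal (L ((1 - g) * f n)) := by
    refine outer_le_tsum (fun n => nonneg_mul g0' (f0 n)) fun x hx => ?_
    obtain ⟨n, hn⟩ := f1 x (Or.inr hx)
    exact ⟨n, by change 1 ≤ (1 - g.1 x) * (f n).1 x; rwa [gt x hx, sub_zero, one_mul]⟩
  refine (add_le_add hs ht).trans_eq ?_
  rw [← ENNReal.tsum_add]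
  refine tsum_congr fun n => ?_
  rw [← ENNReal.ofReal_add (hpos _ (nonneg_mul g0 (f0 n))) (hpos _ (nonneg_mul g0' (f0 n))),
    ← map_add, ← add_mul, add_sub_cancel, one_mul]

theorem isMetric_outer (hpos : ∀ f : bLip α, (∀ x, 0 ≤ f.1 x) → 0 ≤ L f) :
    ∀ s t : Set α, Metric.AreSeparated s t → outer L (s ∪ t) = outer L s + outer L t :=
  fun s t h => le_antisymm (measure_union_le s t) (outer_add_le hpos h)

theorem outer_univ (hpos : ∀ f : bLip α, (∀ x, 0 ≤ f.1 x) → 0 ≤ L f) (hone : L 1 = 1)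
    (hreg : ∀ f : ℕ → bLip α, (∀ x, Antitone fun n => (f n).1 x) →
      (∀ x, Filter.Tendsto (fun n => (f n).1 x) Filter.atTop (nhds 0)) →
      Filter.Tendsto (fun n => L (f n)) Filter.atTop (nhds 0)) : outer L univ = 1 := by
  apply le_antisymm
  · simpa [hone] using outer_le (L := L) (A := univ) (f := 1) (fun _ => zero_le_one)
      (fun _ _ => le_rfl)
  refine ENNReal.le_of_forall_pos_le_add fun ε hε _ => ?_
  obtain ⟨f, f0, f1, hf⟩ := exists_tsum_le_outer_add (L := L) univ hε
  refine le_trans ?_ hf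
  set S : ℕ → bLip α := fun n => ∑ i ∈ Finset.range n, f i with hS
  have hSapp : ∀ n x, (S n).1 x = ∑ i ∈ Finset.range n, (f i).1 x := fun n x => sum_apply _ _ _
  have hmono : ∀ x, Monotone fun n => (S n).1 x := by
    intro x m n hmn
    simp only [hSapp]
    exact Finset.sum_le_sum_of_subset_of_nonneg (Finset.range_mono hmn) fun i _ _ => f0 i x
  have hS0 : ∀ n x, 0 ≤ (S n).1 x := fun n x => by
    rw [hSapp]; exact Finset.sum_nonneg fun i _ => f0 i x
  have hsub : ∀ n x, (1 - S n).1 x = 1 - (S n).1 x := fun _ _ => rfl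
  have hlim : Filter.Tendsto (fun n => L (clamp (1 - S n))) Filter.atTop (nhds 0) := by
    refine hreg _ (fun x m n hmn => ?_) fun x => ?_
    · have := hmono x hmn
      simp only [clamp_apply, hsub]
      gcongr
    · obtain ⟨N, hN⟩ := f1 x (mem_univ x)
      refine tendsto_const_nhds.congr' ?_
      filter_upwards [Filter.eventually_ge_atTop (N + 1)] with n hn
      have h1 : 1 ≤ (S n).1 x := by
        rw [hSapp]
        exact hN.trans (Finset.single_le_sum (f := fun i => (f i).1 x) (fun i _ => f0 i x)
          (Finset.mem_range.2 hn))
      rw [clamp_apply, hsub, max_eq_right]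
      exact (min_le_left _ _).trans (by linarith)
  have hbound : ∀ n, ENNReal.ofReal (1 - L (clamp (1 - S n))) ≤
      ∑' n, ENNReal.ofReal (L (f n)) := by
    intro n
    have h2 : 0 ≤ L (S n - 1 + clamp (1 - S n)) := by
      refine hpos _ fun x => ?_
      change 0 ≤ (S n).1 x - 1 + (clamp (1 - S n)).1 x
      rw [clamp_apply, hsub, min_eq_left (by linarith [hS0 n x])]
      linarith [le_max_left (1 - (S n).1 x) 0]
    rw [map_add, map_sub, hone] at h2
    calc ENNReal.ofReal (1 - L (clamp (1 - S n))) ≤ ENNReal.ofReal (L (S n)) :=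
          ENNReal.ofReal_le_ofReal (by linarith)
      _ = ∑ i ∈ Finset.range n, ENNReal.ofReal (L (f i)) := by
          rw [hS, map_sum, ENNReal.ofReal_sum_of_nonneg fun i _ => hpos _ (f0 i)]
      _ ≤ _ := ENNReal.sum_le_tsum _
  have hlim' : Filter.Tendsto (fun n => ENNReal.ofReal (1 - L (clamp (1 - S n)))) Filter.atTop
      (nhds 1) := by
    have := ENNReal.tendsto_ofReal (hlim.const_sub 1)
    simpa using this
  exact le_of_tendsto' hlim' hbound

end Daniell

/-- The sum of the consecutive unit truncations of `y ∈ [0, n]` is `y`. -/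
theorem sum_truncation {n : ℕ} {y : ℝ} (h0 : 0 ≤ y) (h1 : y ≤ n) :
    ∑ k ∈ Finset.range n, max (min (y - k) 1) 0 = y := by
  have key : ∀ m : ℕ, ∑ k ∈ Finset.range m, max (min (y - k) 1) 0 = min y m := by
    intro m
    induction m with
    | zero => simp [h0]
    | succ m ih =>
      rw [Finset.sum_range_succ, ih]
      push_cast
      rcases le_total y m with h | h
      · rw [min_eq_left h, min_eq_left (by linarith : y ≤ m + 1),
          max_eq_right ((min_le_left _ _).trans (by linarith)), add_zero]
      · rw [min_eq_right h]
        rcases le_total y (m + 1) with h' | h'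
        · rw [min_eq_left h', min_eq_left (by linarith), max_eq_left (by linarith)]; ring
        · rw [min_eq_right h', min_eq_right (by linarith), max_eq_left (by linarith)]
  rw [key, min_eq_left h1]

theorem le_sum_indicator {n : ℕ} {y : ℝ} (h1 : y ≤ n) :
    y ≤ 1 + ∑ k ∈ Finset.range n, if (k : ℝ) + 1 ≤ y then (1 : ℝ) else 0 := by
  have key : ∀ m : ℕ, min y m ≤
      1 + ∑ k ∈ Finset.range m, if (k : ℝ) + 1 ≤ y then (1 : ℝ) else 0 := by
    intro m
    induction m with
    | zero => simp
    | succ m ih =>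
      rw [Finset.sum_range_succ]
      push_cast
      have hS : 0 ≤ ∑ k ∈ Finset.range m, if (k : ℝ) + 1 ≤ y then (1 : ℝ) else 0 :=
        Finset.sum_nonneg fun _ _ => by split_ifs <;> norm_num
      by_cases h : (m : ℝ) + 1 ≤ y
      · rw [if_pos h, min_eq_right h]
        rw [min_eq_right (by linarith)] at ih
        linarith
      · rw [if_neg h, min_eq_left (by linarith)]
        rcases le_total y m with h' | h'
        · rw [min_eq_left h'] at ih
          linarith
        · have hm : ∑ k ∈ Finset.range m, (if (k : ℝ) + 1 ≤ y then (1 : ℝ) else 0) = m := by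
            rw [Finset.sum_congr rfl (g := fun _ => (1 : ℝ)), Finset.sum_const, Finset.card_range,
              nsmul_one]
            intro k hk
            have : (k : ℝ) + 1 ≤ m := by exact_mod_cast Finset.mem_range.1 hk
            exact if_pos (this.trans h')
          rw [hm]
          linarith
  simpa [min_eq_left h1] using key n

section Measure

variable {α : Type*} [MetricSpace α] [MeasurableSpace α]

theorem real_le_of_measure_le {μ : Measure α} {L : bLip α →ₗ[ℝ] ℝ}
    (hpos : ∀ f : bLip α, (∀ x, 0 ≤ f.1 x) → 0 ≤ L f)
    (hμ : ∀ (A : Set α) (f : bLip α), MeasurableSet A → (∀ x, 0 ≤ f.1 x) →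
      (∀ x ∈ A, 1 ≤ f.1 x) → μ A ≤ ENNReal.ofReal (L f))
    {A : Set α} {f : bLip α} (hA : MeasurableSet A) (h0 : ∀ x, 0 ≤ f.1 x)
    (h1 : ∀ x ∈ A, 1 ≤ f.1 x) : μ.real A ≤ L f :=
  ENNReal.toReal_le_of_le_ofReal (hpos f h0) (hμ A f hA h0 h1)

variable [BorelSpace α]

theorem integral_le_of_measure_le {μ : Measure α} [IsProbabilityMeasure μ] {L : bLip α →ₗ[ℝ] ℝ}
    (hpos : ∀ f : bLip α, (∀ x, 0 ≤ f.1 x) → 0 ≤ L f)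
    (hμ : ∀ (A : Set α) (f : bLip α), MeasurableSet A → (∀ x, 0 ≤ f.1 x) →
      (∀ x ∈ A, 1 ≤ f.1 x) → μ A ≤ ENNReal.ofReal (L f))
    {f : bLip α} (h0 : ∀ x, 0 ≤ f.1 x) (h1 : ∀ x, f.1 x ≤ 1) :
    ∫ x, f.1 x ∂μ ≤ L f := by
  have key : ∀ n : ℕ, n * ∫ x, f.1 x ∂μ ≤ 1 + n * L f := by
    intro n
    set A : ℕ → Set α := fun k => {x | (k : ℝ) + 1 ≤ n * f.1 x} with hA
    have hmeas : ∀ k, MeasurableSet (A k) := fun k =>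
      (isClosed_le continuous_const (continuous_const.mul f.2.continuous)).measurableSet
    set T : ℕ → bLip α := fun k => clamp ((n : ℝ) • f - (k : ℝ) • 1) with hT
    have hTapp : ∀ k x, (T k).1 x = max (min (n * f.1 x - k) 1) 0 := by
      intro k x
      rw [hT, clamp_apply]
      change max (min (n * f.1 x - k * 1) 1) 0 = _
      rw [mul_one]
    have hn : ∀ x, n * f.1 x ≤ n := fun x => mul_le_of_le_one_right n.cast_nonneg (h1 x)
    have hsum : ∑ k ∈ Finset.range n, T k = (n : ℝ) • f := by
      apply Subtype.ext
      funext x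
      rw [sum_apply]
      simp only [hTapp]
      exact sum_truncation (mul_nonneg n.cast_nonneg (h0 x)) (hn x)
    have hle : ∀ k, μ.real (A k) ≤ L (T k) := fun k =>
      real_le_of_measure_le hpos hμ (hmeas k) (fun x => by rw [hTapp]; exact le_max_right _ _)
        fun x hx => by
          have hx' : (k : ℝ) + 1 ≤ n * f.1 x := hx
          rw [hTapp, min_eq_right (by linarith)]
          exact le_max_left _ _
    have hint : ∀ k, Integrable ((A k).indicator (fun _ => (1 : ℝ))) μ := fun k =>
      (integrable_const _).indicator (hmeas k)
    calc n * ∫ x, f.1 x ∂μ = ∫ x, n * f.1 x ∂μ := (integral_const_mul _ _).symm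
      _ ≤ ∫ x, (1 + ∑ k ∈ Finset.range n, (A k).indicator (fun _ => (1 : ℝ)) x) ∂μ := by
          refine integral_mono ((f.2.integrable μ).const_mul _)
            ((integrable_const _).add (integrable_finsetSum _ fun k _ => hint k)) fun x => ?_
          simpa only [indicator_apply, hA, mem_ofPred_eq] using le_sum_indicator (hn x)
      _ = 1 + ∑ k ∈ Finset.range n, μ.real (A k) := by
          rw [integral_add (integrable_const _) (integrable_finsetSum _ fun k _ => hint k),
            integral_finsetSum _ fun k _ => hint k]
          simp [integral_indicator_const _ (hmeas _)]
      _ ≤ 1 + ∑ k ∈ Finset.range n, L (T k) := by gcongr with k _; exact hle k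
      _ = 1 + n * L f := by rw [← map_sum, hsum, map_smul, smul_eq_mul]
  by_contra! hlt
  obtain ⟨n, hn⟩ := exists_nat_gt (1 / (∫ x, f.1 x ∂μ - L f))
  rw [div_lt_iff₀ (sub_pos.2 hlt)] at hn
  linarith [key n]

theorem integral_eq_of_measure_le {μ : Measure α} [IsProbabilityMeasure μ] {L : bLip α →ₗ[ℝ] ℝ}
    (hpos : ∀ f : bLip α, (∀ x, 0 ≤ f.1 x) → 0 ≤ L f) (hone : L 1 = 1)
    (hμ : ∀ (A : Set α) (f : bLip α), MeasurableSet A → (∀ x, 0 ≤ f.1 x) →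
      (∀ x ∈ A, 1 ≤ f.1 x) → μ A ≤ ENNReal.ofReal (L f)) (f : bLip α) :
    ∫ x, f.1 x ∂μ = L f := by
  have key : ∀ f : bLip α, ∫ x, f.1 x ∂μ ≤ L f := by
    intro f
    obtain ⟨C, hC⟩ := f.2.2
    set D : ℝ := |C| + 1
    have hD : 0 < D := by positivity
    have hfD : ∀ x, |f.1 x| ≤ D := fun x => by linarith [hC x, le_abs_self C]
    have happ : ∀ x, ((2 * D)⁻¹ • (f + D • 1)).1 x = (2 * D)⁻¹ * (f.1 x + D) := fun x => by
      change (2 * D)⁻¹ * (f.1 x + D * 1) = _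
      rw [mul_one]
    have h := integral_le_of_measure_le hpos hμ (f := (2 * D)⁻¹ • (f + D • 1))
      (fun x => by
        rw [happ]
        have := neg_le_of_abs_le (hfD x)
        exact mul_nonneg (by positivity) (by linarith))
      (fun x => by
        rw [happ, inv_mul_le_one₀ (by positivity)]
        linarith [le_of_abs_le (hfD x)])
    simp only [happ] at h
    rw [integral_const_mul, integral_add (f.2.integrable μ) (integrable_const _), map_smul,
      map_add, map_smul, hone, smul_eq_mul, smul_eq_mul, mul_one, integral_const] at h
    have h' := le_of_mul_le_mul_left h (by positivity)
    simpa using h'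
  refine le_antisymm (key f) ?_
  have h := key (-f)
  rw [map_neg] at h
  have h2 : ∫ x, (-f).1 x ∂μ = -∫ x, f.1 x ∂μ := integral_neg _
  linarith

/-- A Daniell representation theorem: a positive normalised linear functional on the bounded
Lipschitz functions that is continuous along sequences decreasing to zero is the integral against
a probability measure. -/
theorem exists_probabilityMeasure {L : bLip α →ₗ[ℝ] ℝ}
    (hpos : ∀ f : bLip α, (∀ x, 0 ≤ f.1 x) → 0 ≤ L f) (hone : L 1 = 1)
    (hreg : ∀ f : ℕ → bLip α, (∀ x, Antitone fun n => (f n).1 x) →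
      (∀ x, Filter.Tendsto (fun n => (f n).1 x) Filter.atTop (nhds 0)) →
      Filter.Tendsto (fun n => L (f n)) Filter.atTop (nhds 0)) :
    ∃ P : ProbabilityMeasure α, ∀ f : bLip α, ∫ x, f.1 x ∂(P : Measure α) = L f := by
  have hmet : (outer L).IsMetric := isMetric_outer hpos
  have hcar : ‹MeasurableSpace α› ≤ (outer L).caratheodory := by
    rw [BorelSpace.measurable_eq (α := α)]
    exact hmet.borel_le_caratheodory
  have happ : ∀ A, MeasurableSet A → (outer L).toMeasure hcar A = outer L A := fun A hA =>
    toMeasure_apply _ _ hA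
  have hprob : IsProbabilityMeasure ((outer L).toMeasure hcar) :=
    ⟨by rw [happ _ MeasurableSet.univ, outer_univ hpos hone hreg]⟩
  refine ⟨⟨_, hprob⟩, integral_eq_of_measure_le (μ := (outer L).toMeasure hcar) hpos hone
    fun A f hA h0 h1 => ?_⟩
  rw [happ A hA]
  exact outer_le h0 h1

end Measure

end bLip

/-- A sublinear functional on a real vector space is attained at any given point by a dominated
linear functional. -/
theorem exists_linearMap_le_sublinear_eq {E : Type*} [AddCommGroup E] [Module ℝ E] {N : E → ℝ}
    (N_hom : ∀ c : ℝ, 0 ≤ c → ∀ x, N (c • x) = c * N x)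
    (N_add : ∀ x y, N (x + y) ≤ N x + N y) (x : E) :
    ∃ L : E →ₗ[ℝ] ℝ, L x = N x ∧ ∀ y, L y ≤ N y := by
  have N_zero : N 0 = 0 := by simpa using N_hom 0 le_rfl 0
  have hN : ∀ c : ℝ, c * N x ≤ N (c • x) := by
    intro c
    rcases le_total 0 c with hc | hc
    · exact (N_hom c hc x).ge
    · have h := N_add (c • x) ((-c) • x)
      rw [← add_smul, add_neg_cancel, zero_smul, N_zero, N_hom (-c) (neg_nonneg.2 hc)] at h
      linarith
  have hwd : ∀ c : ℝ, c • x = 0 → (RingHom.id ℝ) c • N x = 0 := by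
    intro c hc
    have h1 := hN c
    have h2 := hN (-c)
    rw [neg_smul, hc, neg_zero, N_zero] at h2
    rw [hc, N_zero] at h1
    rw [RingHom.id_apply, smul_eq_mul]
    linarith
  obtain ⟨L, hL, hLN⟩ := exists_extension_of_le_sublinear
    (LinearPMap.mkSpanSingleton' x (N x) hwd) N (fun c hc => N_hom c hc.le) N_add (by
      rintro ⟨y, hy⟩
      obtain ⟨c, rfl⟩ := Submodule.mem_span_singleton.1 hy
      rw [LinearPMap.mkSpanSingleton'_apply]
      exact hN c)
  refine ⟨L, ?_, hLN⟩
  have hx : x ∈ (LinearPMap.mkSpanSingleton' x (N x) hwd).domain :=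
    Submodule.mem_span_singleton_self x
  rw [hL ⟨x, hx⟩, LinearPMap.mkSpanSingleton'_apply_self]

section DistTruncation

variable {α : Type*} [PseudoMetricSpace α]

/-- The distance to the first points of a sequence, rescaled, shifted and truncated to `[0, 1]`. -/
def distTruncation (u : ℕ → α) (c : ℝ) (n : ℕ) (x : α) : ℝ :=
  min (max (c * Metric.infDist x (u '' Iic n) - 1) 0) 1

theorem distTruncation_nonneg (u : ℕ → α) (c : ℝ) (n : ℕ) (x : α) : 0 ≤ distTruncation u c n x :=
  le_min (le_max_right _ _) zero_le_one

theorem isBLip_distTruncation (u : ℕ → α) (c : ℝ) (n : ℕ) : IsBLip (distTruncation u c n) := by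
  have h1 : LipschitzWith _ fun x => c * Metric.infDist x (u '' Iic n) - 1 :=
    ((lipschitzWith_smul c).comp (Metric.lipschitz_infDist_pt (u '' Iic n))).sub
      (LipschitzWith.const 1)
  refine ⟨⟨_, (h1.max_const 0).min_const 1⟩, 1, fun x => ?_⟩
  rw [abs_of_nonneg (distTruncation_nonneg u c n x)]
  exact min_le_right _ _

theorem antitone_distTruncation (u : ℕ → α) {c : ℝ} (hc : 0 ≤ c) (x : α) :
    Antitone fun n => distTruncation u c n x := fun _ _ hmn =>
  min_le_min_right _ <| max_le_max_right _ <| sub_le_sub_right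
    (mul_le_mul_of_nonneg_left (Metric.infDist_le_infDist_of_subset
      (image_mono (Iic_subset_Iic.2 hmn)) (nonempty_Iic.image u)) hc) _

theorem tendsto_distTruncation {u : ℕ → α} (hu : DenseRange u) {c : ℝ} (hc : 0 < c) (x : α) :
    Filter.Tendsto (fun n => distTruncation u c n x) Filter.atTop (nhds 0) := by
  obtain ⟨m, hm⟩ := Metric.denseRange_iff.1 hu x c⁻¹ (inv_pos.2 hc)
  refine tendsto_const_nhds.congr' ?_
  filter_upwards [Filter.eventually_ge_atTop m] with n hn
  have hmem : u m ∈ u '' Iic n := mem_image_of_mem u (mem_Iic.2 hn)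
  have h1 : Metric.infDist x (u '' Iic n) ≤ c⁻¹ :=
    (Metric.infDist_le_dist_of_mem hmem).trans hm.le
  have h2 : c * Metric.infDist x (u '' Iic n) ≤ 1 :=
    (mul_le_mul_of_nonneg_left h1 hc.le).trans_eq (mul_inv_cancel₀ hc.ne')
  have h3 : max (c * Metric.infDist x (u '' Iic n) - 1) 0 = 0 := max_eq_right (sub_nonpos.2 h2)
  rw [distTruncation, h3, min_eq_left zero_le_one]

end DistTruncation

section DominatedMeasures

variable {α : Type*} [MetricSpace α] [MeasurableSpace α] [BorelSpace α]

/-- The probability measures whose integral is dominated by `N` on bounded Lipschitz functions. -/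
def dominatedMeasures (N : (α → ℝ) → ℝ) : Set (ProbabilityMeasure α) :=
  {P | ∀ X : α → ℝ, IsBLip X → ∫ x, X x ∂(P : Measure α) ≤ N X}

theorem convexPM_dominatedMeasures (N : (α → ℝ) → ℝ) : ConvexPM (dominatedMeasures N) := by
  intro P hP Q hQ a ha
  have hprob : IsProbabilityMeasure
      ((a : ℝ≥0∞) • (P : Measure α) + ((1 - a : ℝ≥0) : ℝ≥0∞) • (Q : Measure α)) := by
    constructor
    simp only [Measure.add_apply, Measure.smul_apply, measure_univ, smul_eq_mul, mul_one]
    rw [← ENNReal.coe_add, add_tsub_cancel_of_le ha, ENNReal.coe_one]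
  refine ⟨⟨_, hprob⟩, fun X hX => ?_, rfl⟩
  change ∫ x, X x ∂((a : ℝ≥0∞) • (P : Measure α) + ((1 - a : ℝ≥0) : ℝ≥0∞) • (Q : Measure α)) ≤ _
  rw [integral_add_measure ((hX.integrable _).smul_measure ENNReal.coe_ne_top)
    ((hX.integrable _).smul_measure ENNReal.coe_ne_top), integral_smul_measure,
    integral_smul_measure, ENNReal.coe_toReal, ENNReal.coe_toReal, NNReal.coe_sub ha,
    NNReal.coe_one, smul_eq_mul, smul_eq_mul]
  have h1 := mul_le_mul_of_nonneg_left (hP X hX) a.2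
  have h2 := mul_le_mul_of_nonneg_left (hQ X hX) (sub_nonneg.2 (NNReal.coe_le_one.2 ha))
  change a * ∫ x, X x ∂(P : Measure α) ≤ a * N X at h1
  linarith

theorem isClosed_dominatedMeasures (N : (α → ℝ) → ℝ) : IsClosed (dominatedMeasures N) := by
  have h : dominatedMeasures N = ⋂ (X : α → ℝ) (_ : IsBLip X),
      {P : ProbabilityMeasure α | ∫ x, X x ∂(P : Measure α) ≤ N X} := by
    ext P
    simp [dominatedMeasures]
  rw [h]
  refine isClosed_iInter fun X => isClosed_iInter fun hX => isClosed_le ?_ continuous_const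
  obtain ⟨C, hC⟩ := hX.2
  exact continuous_iff_continuousAt.2 fun P =>
    ProbabilityMeasure.tendsto_iff_forall_integral_tendsto.1 Filter.tendsto_id
      (BoundedContinuousFunction.ofNormedAddCommGroup X hX.continuous C hC)

theorem exists_measure_far_le {N : (α → ℝ) → ℝ}
    (reg : ∀ f : ℕ → α → ℝ, (∀ k, IsBLip (f k)) → (∀ x, Antitone fun k => f k x) →
      (∀ x, Filter.Tendsto (fun k => f k x) Filter.atTop (nhds 0)) →
      Filter.Tendsto (fun k => N (f k)) Filter.atTop (nhds 0))
    {u : ℕ → α} (hu : DenseRange u) {r : ℝ} (hr : 0 < r) {ε : ℝ≥0} (hε : 0 < ε) :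
    ∃ n : ℕ, ∀ P ∈ dominatedMeasures N,
      (P : Measure α) {x | r < Metric.infDist x (u '' Iic n)} ≤ ε := by
  have hblip := isBLip_distTruncation u (2 / r)
  have hc0 : 0 < 2 / r := by positivity
  have hlim := reg (distTruncation u (2 / r)) hblip (antitone_distTruncation u hc0.le)
    (tendsto_distTruncation hu hc0)
  obtain ⟨n, hn⟩ := (hlim.eventually_lt_const (NNReal.coe_pos.2 hε)).exists
  refine ⟨n, fun P hP => ?_⟩
  have hsub : {x | r < Metric.infDist x (u '' Iic n)} ⊆ {x | 1 ≤ distTruncation u (2 / r) n x} := by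
    intro x hx
    have h1 : 2 / r * r < 2 / r * Metric.infDist x (u '' Iic n) := mul_lt_mul_of_pos_left hx hc0
    rw [div_mul_cancel₀ _ hr.ne'] at h1
    have h2 : 1 ≤ 2 / r * Metric.infDist x (u '' Iic n) - 1 := by linarith
    exact le_min (le_max_of_le_left h2) le_rfl
  have h3 := mul_meas_ge_le_integral_of_nonneg (μ := (P : Measure α))
    (Filter.Eventually.of_forall (distTruncation_nonneg u (2 / r) n)) ((hblip n).integrable _) 1
  rw [one_mul] at h3
  have h4 := h3.trans ((hP _ (hblip n)).trans hn.le)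
  refine (measure_mono hsub).trans ?_
  rw [← ENNReal.ofReal_coe_nnreal]
  exact (ENNReal.le_ofReal_iff_toReal_le (measure_ne_top _ _) ε.2).2 h4

theorem isTightMeasureSet_dominatedMeasures [CompleteSpace α] [TopologicalSpace.SeparableSpace α]
    [Nonempty α] {N : (α → ℝ) → ℝ}
    (reg : ∀ f : ℕ → α → ℝ, (∀ k, IsBLip (f k)) → (∀ x, Antitone fun k => f k x) →
      (∀ x, Filter.Tendsto (fun k => f k x) Filter.atTop (nhds 0)) →
      Filter.Tendsto (fun k => N (f k)) Filter.atTop (nhds 0)) :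
    IsTightMeasureSet {((P : ProbabilityMeasure α) : Measure α) | P ∈ dominatedMeasures N} := by
  rw [isTightMeasureSet_iff_exists_isCompact_measure_compl_le]
  intro ε hε
  obtain ⟨u, hu⟩ := TopologicalSpace.exists_dense_seq α
  obtain ⟨δ, hδ, hδsum⟩ := ENNReal.exists_pos_sum_of_countable hε.ne' ℕ
  choose n hn using fun m : ℕ => exists_measure_far_le reg hu (Nat.one_div_pos_of_nat (n := m)
    (α := ℝ)) (hδ m)
  set K : Set α := ⋂ m : ℕ, {x | Metric.infDist x (u '' Iic (n m)) ≤ 1 / ((m : ℝ) + 1)} with hK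
  have hclosed : IsClosed K := isClosed_iInter fun m =>
    isClosed_le (Metric.continuous_infDist_pt _) continuous_const
  have htb : TotallyBounded K := by
    refine Metric.totallyBounded_iff.2 fun r hr => ?_
    obtain ⟨m, hm⟩ := exists_nat_one_div_lt hr
    refine ⟨u '' Iic (n m), (finite_Iic _).image u, fun x hx => ?_⟩
    have hx' : Metric.infDist x (u '' Iic (n m)) < r := (mem_iInter.1 hx m).trans_lt hm
    obtain ⟨y, hy, hxy⟩ := (Metric.infDist_lt_iff (nonempty_Iic.image u)).1 hx'
    exact mem_iUnion₂.2 ⟨y, hy, hxy⟩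
  refine ⟨K, htb.isCompact_of_isClosed hclosed, ?_⟩
  rintro _ ⟨P, hP, rfl⟩
  have hcompl : Kᶜ = ⋃ m : ℕ, {x | 1 / ((m : ℝ) + 1) < Metric.infDist x (u '' Iic (n m))} := by
    rw [hK, compl_iInter]
    refine iUnion_congr fun m => ?_
    ext x
    simp
  rw [hcompl]
  exact (measure_iUnion_le _).trans ((ENNReal.tsum_le_tsum fun m => hn m P hP).trans hδsum.le)

theorem isCompact_dominatedMeasures [CompleteSpace α] [TopologicalSpace.SeparableSpace α]
    [Nonempty α] {N : (α → ℝ) → ℝ}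
    (reg : ∀ f : ℕ → α → ℝ, (∀ k, IsBLip (f k)) → (∀ x, Antitone fun k => f k x) →
      (∀ x, Filter.Tendsto (fun k => f k x) Filter.atTop (nhds 0)) →
      Filter.Tendsto (fun k => N (f k)) Filter.atTop (nhds 0)) :
    IsCompact (dominatedMeasures N) :=
  (isClosed_dominatedMeasures N).closure_eq ▸
    isCompact_closure_of_isTightMeasureSet (isTightMeasureSet_dominatedMeasures reg)

end DominatedMeasures

/-- representation theorem for a regular sublinear expectation on the
bounded Lipschitz functions on a complete separable metric space. -/
theorem sublinear_expectation_representation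
    {Ω : Type*} [MetricSpace Ω] [CompleteSpace Ω] [TopologicalSpace.SeparableSpace Ω]
    [MeasurableSpace Ω] [BorelSpace Ω]
    (Ehat : (Ω → ℝ) → ℝ)
    (mono : ∀ X Y : Ω → ℝ, IsBLip X → IsBLip Y → (∀ ω, X ω ≤ Y ω) → Ehat X ≤ Ehat Y)
    (const : ∀ c : ℝ, Ehat (fun _ => c) = c)
    (subadd : ∀ X Y : Ω → ℝ, IsBLip X → IsBLip Y →
      Ehat (fun ω => X ω + Y ω) ≤ Ehat X + Ehat Y)
    (poshom : ∀ (X : Ω → ℝ) (lam : ℝ), IsBLip X → 0 ≤ lam →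
      Ehat (fun ω => lam * X ω) = lam * Ehat X)
    (reg : ∀ f : ℕ → Ω → ℝ, (∀ k, IsBLip (f k)) → (∀ ω, Antitone fun k => f k ω) →
      (∀ ω, Filter.Tendsto (fun k => f k ω) Filter.atTop (nhds 0)) →
      Filter.Tendsto (fun k => Ehat (f k)) Filter.atTop (nhds 0)) :
    ∃ Pset : Set (ProbabilityMeasure Ω), ConvexPM Pset ∧ IsCompact Pset ∧
      ∀ X : Ω → ℝ, IsBLip X →
        Ehat X = ⨆ P : Pset, ∫ ω, X ω ∂((P : ProbabilityMeasure Ω) : Measure Ω) := by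
  have hne : Nonempty Ω := by
    by_contra h
    rw [not_nonempty_iff] at h
    have h01 : (fun _ : Ω => (0 : ℝ)) = fun _ => 1 := Subsingleton.elim _ _
    have h := const 0
    rw [h01, const 1] at h
    exact one_ne_zero h
  refine ⟨dominatedMeasures Ehat, convexPM_dominatedMeasures Ehat,
    isCompact_dominatedMeasures reg, fun X hX => ?_⟩
  obtain ⟨L, hLX, hL⟩ := exists_linearMap_le_sublinear_eq
    (N := fun f : bLip Ω => Ehat f.1) (fun c hc f => poshom f.1 c f.2 hc)
    (fun f g => subadd f.1 g.1 f.2 g.2) ⟨X, hX⟩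
  have hpos : ∀ f : bLip Ω, (∀ x, 0 ≤ f.1 x) → 0 ≤ L f := by
    intro f hf
    have h1 : Ehat (-f).1 ≤ 0 :=
      (mono _ _ (-f).2 (IsBLip.const 0) fun x => neg_nonpos.2 (hf x)).trans_eq (const 0)
    have h2 := (hL (-f)).trans h1
    rw [map_neg] at h2
    linarith
  have hone : L 1 = 1 := by
    refine le_antisymm ((hL 1).trans_eq (const 1)) ?_
    have h := (hL (-1)).trans_eq (const (-1))
    rw [map_neg] at h
    linarith
  obtain ⟨P, hP⟩ := bLip.exists_probabilityMeasure hpos hone fun f hanti hlim =>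
    squeeze_zero (fun n => hpos _ fun x => (hanti x).le_of_tendsto (hlim x) n) (fun n => hL (f n))
      (reg (fun n => (f n).1) (fun n => (f n).2) hanti hlim)
  have hPmem : P ∈ dominatedMeasures Ehat := fun Y hY => (hP ⟨Y, hY⟩).trans_le (hL ⟨Y, hY⟩)
  have : Nonempty (dominatedMeasures Ehat) := ⟨⟨P, hPmem⟩⟩
  refine le_antisymm ?_ (ciSup_le fun Q => Q.2 X hX)
  have hbdd : BddAbove (range fun Q : dominatedMeasures Ehat =>
      ∫ ω, X ω ∂((Q : ProbabilityMeasure Ω) : Measure Ω)) :=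
    ⟨Ehat X, by rintro _ ⟨Q, rfl⟩; exact Q.2 X hX⟩
  exact (hLX.symm.trans (hP ⟨X, hX⟩).symm).trans_le (le_ciSup hbdd ⟨P, hPmem⟩)
end
end

section
/- Let X_1, …, X_n be independent under Ê with sup_{P ∈ 𝒫} E_P[|X_i|²] < ∞ for each i. Then for every P ∈ 𝒫, every Lipschitz function φ : ℝ^d → ℝ, and every i ≤ n, one has E_P[φ(X_i) | F_{i−1}] ≤ Ê[φ(X_i)] P-almost surely. -/
open MeasureTheory Set
open scoped NNReal ENNReal RealInnerProductSpace

noncomputable section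

variable {Ω : Type*} [MeasurableSpace Ω] [TopologicalSpace Ω]

open Filter Topology in
theorem measure_le_of_forall_lipschitzWith_lintegral_le {E : Type*} [PseudoEMetricSpace E]
    [MeasurableSpace E] [BorelSpace E] {μ ν : Measure E} [IsFiniteMeasure μ] [IsFiniteMeasure ν]
    (h : ∀ g : E → ℝ≥0, (∃ K, LipschitzWith K g) → (∀ x, g x ≤ 1) →
      ∫⁻ x, g x ∂μ ≤ ∫⁻ x, g x ∂ν) : μ ≤ ν := by
  have hclosed : ∀ F : Set E, IsClosed F → μ F ≤ ν F := by
    intro F hF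
    have hpos : ∀ n : ℕ, (0 : ℝ) < 1 / ((n : ℝ) + 1) := fun n => Nat.one_div_pos_of_nat
    have hlim := tendsto_one_div_add_atTop_nhds_zero_nat (𝕜 := ℝ)
    exact le_of_tendsto_of_tendsto'
      (tendsto_lintegral_thickenedIndicator_of_isClosed μ hF hpos hlim)
      (tendsto_lintegral_thickenedIndicator_of_isClosed ν hF hpos hlim)
      fun n => h _ ⟨_, lipschitzWith_thickenedIndicator (hpos n) F⟩
        (thickenedIndicator_le_one (hpos n) F)
  refine Measure.le_iff.2 fun A hA => ?_
  rw [hA.measure_eq_iSup_isClosed_of_ne_top (measure_ne_top μ A)]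
  exact iSup₂_le fun F hFA => iSup_le fun hF => (hclosed F hF).trans (measure_mono hFA)

theorem setIntegral_preimage_nonpos_of_forall_lipschitzWith {Ω E : Type*} [MeasurableSpace Ω]
    [PseudoEMetricSpace E] [MeasurableSpace E] [BorelSpace E] {μ : Measure Ω}
    {Y : Ω → E} (hY : Measurable Y) {f : Ω → ℝ} (hf : Measurable f) (hfi : Integrable f μ)
    (h : ∀ g : E → ℝ≥0, (∃ K, LipschitzWith K g) → (∀ x, g x ≤ 1) →
      ∫ ω, (g (Y ω) : ℝ) * f ω ∂μ ≤ 0) {A : Set E} (hA : MeasurableSet A) :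
    ∫ ω in Y ⁻¹' A, f ω ∂μ ≤ 0 := by
  have hfin : ∀ u : Ω → ℝ, Integrable u μ →
      IsFiniteMeasure (μ.withDensity fun ω => ENNReal.ofReal (u ω)) := fun u hu =>
    isFiniteMeasure_withDensity_ofReal hu.2
  have := hfin f hfi
  have := hfin (fun ω => -f ω) hfi.neg
  have hlint : ∀ u : Ω → ℝ, Measurable u → ∀ g : E → ℝ≥0, Measurable g →
      ∫⁻ x, g x ∂((μ.withDensity fun ω => ENNReal.ofReal (u ω)).map Y)
        = ∫⁻ ω, ENNReal.ofReal (g (Y ω) * u ω) ∂μ := by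
    intro u hu g hg
    rw [lintegral_map (by fun_prop) hY,
      lintegral_withDensity_eq_lintegral_mul _ (by fun_prop) (by fun_prop)]
    refine lintegral_congr fun ω => ?_
    rw [Pi.mul_apply, ENNReal.ofReal_mul (NNReal.coe_nonneg _), ENNReal.ofReal_coe_nnreal, mul_comm]
  have hle : (μ.withDensity fun ω => ENNReal.ofReal (f ω)).map Y
      ≤ (μ.withDensity fun ω => ENNReal.ofReal (-f ω)).map Y := by
    refine measure_le_of_forall_lipschitzWith_lintegral_le fun g hg hg1 => ?_
    have hgm : Measurable g := hg.choose_spec.continuous.measurable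
    have hgfi : Integrable (fun ω => (g (Y ω) : ℝ) * f ω) μ :=
      hfi.bdd_mul (c := 1) (hgm.comp hY).coe_nnreal_real.aestronglyMeasurable
        (ae_of_all _ fun ω => by simpa using hg1 (Y ω))
    rw [hlint f hf g hgm, hlint (fun ω => -f ω) hf.neg g hgm]
    have hint := h g hg hg1
    rw [integral_eq_lintegral_pos_part_sub_lintegral_neg_part hgfi, sub_nonpos] at hint
    simp only [mul_neg]
    exact (ENNReal.toReal_le_toReal hgfi.lintegral_lt_top.ne hgfi.neg.lintegral_lt_top.ne).1 hint
  have hAle := hle A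
  rw [Measure.map_apply hY hA, Measure.map_apply hY hA, withDensity_apply _ (hY hA),
    withDensity_apply _ (hY hA)] at hAle
  rw [integral_eq_lintegral_pos_part_sub_lintegral_neg_part hfi.integrableOn, sub_nonpos]
  exact ENNReal.toReal_mono hfi.integrableOn.neg.lintegral_lt_top.ne hAle

theorem integral_le_hatE {Ω : Type*} [MeasurableSpace Ω] {Pset : Set (ProbabilityMeasure Ω)}
    {f : Ω → ℝ} {C : ℝ} (hC : ∀ Q ∈ Pset, ∫ ω, f ω ∂(Q : Measure Ω) ≤ C)
    {P : ProbabilityMeasure Ω} (hP : P ∈ Pset) :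
    ∫ ω, f ω ∂(P : Measure Ω) ≤ hatE Pset f :=
  le_ciSup (f := fun Q : Pset => ∫ ω, f ω ∂((Q : ProbabilityMeasure Ω) : Measure Ω))
    ⟨C, by rintro _ ⟨Q, rfl⟩; exact hC Q Q.2⟩ ⟨P, hP⟩

theorem hatE_le {Ω : Type*} [MeasurableSpace Ω] {Pset : Set (ProbabilityMeasure Ω)}
    (hne : Pset.Nonempty) {f : Ω → ℝ} {C : ℝ}
    (hC : ∀ Q ∈ Pset, ∫ ω, f ω ∂(Q : Measure Ω) ≤ C) : hatE Pset f ≤ C :=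
  have := hne.to_subtype
  ciSup_le fun Q => hC Q Q.2

theorem isBLip_mul_fst_snd {α β : Type*} [PseudoMetricSpace α] [PseudoMetricSpace β]
    {f : α → ℝ} {g : β → ℝ} (hf : IsBLip f) (hg : IsBLip g) :
    IsBLip fun z : α × β => f z.1 * g z.2 := by
  obtain ⟨⟨K, hK⟩, C, hC⟩ := hf
  obtain ⟨⟨L, hL⟩, D, hD⟩ := hg
  refine ⟨⟨K * D.toNNReal + C.toNNReal * L, LipschitzWith.of_dist_le_mul fun x y => ?_⟩,
    C * D, fun x => ?_⟩
  · have h1 : |f x.1 - f y.1| ≤ K * dist x y :=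
      (hK.dist_le_mul x.1 y.1).trans (by gcongr; exact le_max_left _ _)
    have h2 : |g x.2 - g y.2| ≤ L * dist x y :=
      (hL.dist_le_mul x.2 y.2).trans (by gcongr; exact le_max_right _ _)
    have h3 : |g x.2| ≤ D.toNNReal := (hD _).trans (Real.le_coe_toNNReal D)
    have h4 : |f y.1| ≤ C.toNNReal := (hC _).trans (Real.le_coe_toNNReal C)
    calc dist (f x.1 * g x.2) (f y.1 * g y.2)
        = |(f x.1 - f y.1) * g x.2 + f y.1 * (g x.2 - g y.2)| := by
          rw [Real.dist_eq]; congr 1; ring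
      _ ≤ |f x.1 - f y.1| * |g x.2| + |f y.1| * |g x.2 - g y.2| := by
          rw [← abs_mul, ← abs_mul]; exact abs_add_le _ _
      _ ≤ K * dist x y * D.toNNReal + C.toNNReal * (L * dist x y) := by gcongr
      _ = _ := by push_cast; ring
  · rw [abs_mul]
    exact mul_le_mul (hC _) (hD _) (abs_nonneg _) ((abs_nonneg _).trans (hC x.1))

theorem abs_max_min_neg_sub_le {x N : ℝ} (hN : 0 < N) :
    |max (min x N) (-N) - x| ≤ x ^ 2 / N := by
  have hx : 0 ≤ x ^ 2 / N := by positivity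
  rcases le_total x N with h | h
  · rcases le_total (-N) x with h' | h'
    · simpa [h, h'] using hx
    · rw [min_eq_left h, max_eq_right h', abs_of_nonneg (by linarith), le_div_iff₀ hN]
      nlinarith
  · rw [min_eq_right h, max_eq_left (by linarith), abs_of_nonpos (by linarith), le_div_iff₀ hN]
    nlinarith

/-- Under independence, a bounded Lipschitz test function of the past does not let a bounded
Lipschitz function of the next variable exceed a bound on its sublinear expectation. -/
theorem IndepUnder.integral_mul_sub_nonpos {Ω : Type*} [MeasurableSpace Ω] {d n : ℕ}
    {Pset : Set (ProbabilityMeasure Ω)} (hne : Pset.Nonempty)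
    {X : Fin n → Ω → EuclideanSpace ℝ (Fin d)} (hmeas : ∀ i, Measurable (X i))
    (hindep : IndepUnder Pset X) {P : ProbabilityMeasure Ω} (hP : P ∈ Pset)
    {k : ℕ} (hk : k + 1 < n) {g : (Fin (k + 1) → EuclideanSpace ℝ (Fin d)) → ℝ≥0}
    (hg : IsBLip fun x => (g x : ℝ)) {f : EuclideanSpace ℝ (Fin d) → ℝ} (hf : IsBLip f) {a : ℝ}
    (ha : ∀ Q ∈ Pset, ∫ ω, f (X ⟨k + 1, hk⟩ ω) ∂(Q : Measure Ω) ≤ a) :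
    ∫ ω, (g fun j => X ⟨j.1, lt_trans j.2 hk⟩ ω : ℝ) * (f (X ⟨k + 1, hk⟩ ω) - a)
      ∂(P : Measure Ω) ≤ 0 := by
  have hfa : IsBLip fun y => f y - a := by
    obtain ⟨⟨K, hK⟩, C, hC⟩ := hf
    refine ⟨⟨K, LipschitzWith.of_dist_le_mul fun x y => ?_⟩, C + |a|, fun x => ?_⟩
    · simpa using hK.dist_le_mul x y
    · exact (abs_sub _ _).trans (by gcongr; exact hC x)
  have hψ := isBLip_mul_fst_snd hg hfa
  have hfm : Measurable f := hf.1.choose_spec.continuous.measurable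
  obtain ⟨C, hC⟩ := hf.2
  obtain ⟨D, hD⟩ := hψ.2
  refine (integral_le_hatE (C := D) (fun Q _ => ?_) hP).trans
    ((hindep k hk _ hψ).trans_le (hatE_le hne fun Q _ => ?_))
  · have := norm_integral_le_of_norm_le_const (μ := (Q : Measure Ω)) (C := D)
      (f := fun ω => (g fun j => X ⟨j.1, lt_trans j.2 hk⟩ ω : ℝ) * (f (X ⟨k + 1, hk⟩ ω) - a))
      (ae_of_all _ fun ω =>
        hD ((fun j : Fin (k + 1) => X ⟨j.1, lt_trans j.2 hk⟩ ω), X ⟨k + 1, hk⟩ ω))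
    simpa using (le_abs_self _).trans this
  · refine integral_nonpos fun ω => hatE_le hne fun R hR => ?_
    have hint : Integrable (fun ω' => f (X ⟨k + 1, hk⟩ ω')) (R : Measure Ω) :=
      .of_bound (hfm.comp (hmeas _)).aestronglyMeasurable C (ae_of_all _ fun ω' => hC _)
    simp only
    rw [integral_const_mul, integral_sub hint (integrable_const a)]
    exact mul_nonpos_of_nonneg_of_nonpos (NNReal.coe_nonneg _) (by simpa using ha R hR)

/-- Second-moment version of `IndepUnder.integral_mul_sub_nonpos` for unbounded functions. -/
theorem IndepUnder.integral_mul_sub_nonpos_of_sq {Ω : Type*} [MeasurableSpace Ω] {d n : ℕ}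
    {Pset : Set (ProbabilityMeasure Ω)} (hne : Pset.Nonempty)
    {X : Fin n → Ω → EuclideanSpace ℝ (Fin d)} (hmeas : ∀ i, Measurable (X i))
    (hindep : IndepUnder Pset X) {P : ProbabilityMeasure Ω} (hP : P ∈ Pset)
    {k : ℕ} (hk : k + 1 < n) {g : (Fin (k + 1) → EuclideanSpace ℝ (Fin d)) → ℝ≥0}
    (hg : ∃ K, LipschitzWith K g) (hg1 : ∀ x, g x ≤ 1)
    {f : EuclideanSpace ℝ (Fin d) → ℝ} (hf : ∃ K, LipschitzWith K f) {B c : ℝ}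
    (hfi : ∀ Q ∈ Pset, Integrable (fun ω => f (X ⟨k + 1, hk⟩ ω)) (Q : Measure Ω))
    (hfsq : ∀ Q ∈ Pset, Integrable (fun ω => f (X ⟨k + 1, hk⟩ ω) ^ 2) (Q : Measure Ω))
    (hB : ∀ Q ∈ Pset, ∫ ω, f (X ⟨k + 1, hk⟩ ω) ^ 2 ∂(Q : Measure Ω) ≤ B)
    (hc : ∀ Q ∈ Pset, ∫ ω, f (X ⟨k + 1, hk⟩ ω) ∂(Q : Measure Ω) ≤ c) :
    ∫ ω, (g fun j => X ⟨j.1, lt_trans j.2 hk⟩ ω : ℝ) * (f (X ⟨k + 1, hk⟩ ω) - c)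
      ∂(P : Measure Ω) ≤ 0 := by
  obtain ⟨K, hK⟩ := hg
  obtain ⟨L, hL⟩ := hf
  have hgm : Measurable g := hK.continuous.measurable
  have hfm : Measurable f := hL.continuous.measurable
  have hXm := hmeas ⟨k + 1, hk⟩
  have hY : Measurable fun ω (j : Fin (k + 1)) => X ⟨j.1, lt_trans j.2 hk⟩ ω :=
    measurable_pi_lambda _ fun j => hmeas _
  have hgY := hgm.comp hY
  have hbound : ∀ N : ℕ,
      ∫ ω, (g fun j => X ⟨j.1, lt_trans j.2 hk⟩ ω : ℝ) * (f (X ⟨k + 1, hk⟩ ω) - c)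
        ∂(P : Measure Ω) ≤ 2 * B * (1 / ((N : ℝ) + 1)) := by
    intro m
    set N : ℝ := (m : ℝ) + 1
    have hN : 0 < N := by positivity
    have hTabs : ∀ y, |max (min (f y) N) (-N)| ≤ N := fun y =>
      abs_le.2 ⟨le_max_right _ _, max_le (min_le_right _ _) (by linarith)⟩
    have hTi : ∀ Q : ProbabilityMeasure Ω,
        Integrable (fun ω => max (min (f (X ⟨k + 1, hk⟩ ω)) N) (-N)) (Q : Measure Ω) := fun Q =>
      .of_bound (Measurable.aestronglyMeasurable (by fun_prop)) N (ae_of_all _ fun ω => hTabs _)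
    have hT := hindep.integral_mul_sub_nonpos hne hmeas hP hk (g := g)
      ⟨⟨K, LipschitzWith.of_dist_le_mul fun x y => hK.dist_le_mul x y⟩, 1,
        fun x => by simpa using hg1 x⟩
      (f := fun y => max (min (f y) N) (-N))
      ⟨⟨L, (hL.min_const N).max_const (-N)⟩, N, hTabs⟩ (a := c + B / N) (by
        intro Q hQ
        calc ∫ ω, max (min (f (X ⟨k + 1, hk⟩ ω)) N) (-N) ∂(Q : Measure Ω)
            ≤ ∫ ω, (f (X ⟨k + 1, hk⟩ ω) + f (X ⟨k + 1, hk⟩ ω) ^ 2 / N) ∂(Q : Measure Ω) :=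
              integral_mono (hTi Q) ((hfi Q hQ).add ((hfsq Q hQ).div_const N)) fun ω => by
                have := (abs_le.1 (abs_max_min_neg_sub_le (x := f (X ⟨k + 1, hk⟩ ω)) hN)).2
                simp only
                linarith
          _ = ∫ ω, f (X ⟨k + 1, hk⟩ ω) ∂(Q : Measure Ω)
              + (∫ ω, f (X ⟨k + 1, hk⟩ ω) ^ 2 ∂(Q : Measure Ω)) / N := by
              rw [integral_add (hfi Q hQ) ((hfsq Q hQ).div_const N), integral_div]
          _ ≤ c + B / N := by
              have := hc Q hQ
              have := hB Q hQ
              gcongr)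
    have hgi : ∀ u : Ω → ℝ, Integrable u (P : Measure Ω) →
        Integrable (fun ω => (g fun j => X ⟨j.1, lt_trans j.2 hk⟩ ω : ℝ) * u ω)
          (P : Measure Ω) := fun u hu =>
      hu.bdd_mul (c := 1) hgY.coe_nnreal_real.aestronglyMeasurable
        (ae_of_all _ fun ω => by simpa using hg1 _)
    have hi1 := hgi (fun ω => max (min (f (X ⟨k + 1, hk⟩ ω)) N) (-N) - (c + B / N))
      ((hTi P).sub (integrable_const (c + B / N)))
    have hi2 : Integrable (fun ω => f (X ⟨k + 1, hk⟩ ω) ^ 2 / N + B / N) (P : Measure Ω) :=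
      ((hfsq P hP).div_const N).add (integrable_const _)
    have hB0 : 0 ≤ B := (integral_nonneg fun ω => sq_nonneg _).trans (hB P hP)
    calc _ ≤ ∫ ω, ((g fun j => X ⟨j.1, lt_trans j.2 hk⟩ ω : ℝ)
            * (max (min (f (X ⟨k + 1, hk⟩ ω)) N) (-N) - (c + B / N))
            + (f (X ⟨k + 1, hk⟩ ω) ^ 2 / N + B / N)) ∂(P : Measure Ω) := by
          refine integral_mono (hgi _ ((hfi P hP).sub (integrable_const c))) (hi1.add hi2)
            fun ω => ?_
          have h1 := (abs_le.1 (abs_max_min_neg_sub_le (x := f (X ⟨k + 1, hk⟩ ω)) hN)).1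
          have h2 : (g fun j => X ⟨j.1, lt_trans j.2 hk⟩ ω : ℝ) ≤ 1 := hg1 _
          have h3 : (0 : ℝ) ≤ g fun j => X ⟨j.1, lt_trans j.2 hk⟩ ω := NNReal.coe_nonneg _
          have h4 : 0 ≤ f (X ⟨k + 1, hk⟩ ω) ^ 2 / N + B / N := by positivity
          simp only
          nlinarith [mul_le_mul_of_nonneg_right h2 h4]
      _ = ∫ ω, (g fun j => X ⟨j.1, lt_trans j.2 hk⟩ ω : ℝ)
            * (max (min (f (X ⟨k + 1, hk⟩ ω)) N) (-N) - (c + B / N)) ∂(P : Measure Ω)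
          + ((∫ ω, f (X ⟨k + 1, hk⟩ ω) ^ 2 ∂(P : Measure Ω)) / N + B / N) := by
          rw [integral_add hi1 hi2,
            integral_add ((hfsq P hP).div_const N) (integrable_const _), integral_div]
          simp
      _ ≤ 0 + (B / N + B / N) := by
          have := hB P hP
          gcongr
      _ = 2 * B * (1 / N) := by ring
  refine ge_of_tendsto' (x := Filter.atTop) ?_ hbound
  simpa using (tendsto_one_div_add_atTop_nhds_zero_nat (𝕜 := ℝ)).const_mul (2 * B)

theorem sigmaF_succ_le_comap {Ω : Type*} {d n k : ℕ} (hk : k + 1 < n)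
    (X : Fin n → Ω → EuclideanSpace ℝ (Fin d)) :
    sigmaF X (k + 1) ≤ MeasurableSpace.comap
      (fun ω (j : Fin (k + 1)) => X ⟨j.1, lt_trans j.2 hk⟩ ω) MeasurableSpace.pi := by
  refine iSup₂_le fun j hj => ?_
  rintro _ ⟨t, ht, rfl⟩
  rw [← BorelSpace.measurable_eq] at ht
  exact ⟨(fun y => y ⟨j, hj⟩) ⁻¹' t, measurable_pi_apply (⟨j, hj⟩ : Fin (k + 1)) ht, rfl⟩

theorem condExp_ae_le_const_of_forall_setIntegral_sub_nonpos {Ω : Type*} {m m₀ : MeasurableSpace Ω}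
    (hm : m ≤ m₀) {μ : Measure Ω} [IsFiniteMeasure μ] {f : Ω → ℝ} (hf : Integrable f μ) {c : ℝ}
    (h : ∀ s, MeasurableSet[m] s → ∫ ω in s, (f ω - c) ∂μ ≤ 0) :
    ∀ᵐ ω ∂μ, (μ[f | m]) ω ≤ c := by
  refine ae_le_of_ae_le_trim (hm := hm) (f₂ := fun _ => c)
    (ae_le_of_forall_setIntegral_le
      (integrable_condExp.trim hm stronglyMeasurable_condExp) (integrable_const c)
      fun s hs _ => ?_)
  rw [← setIntegral_trim hm stronglyMeasurable_condExp hs,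
    ← setIntegral_trim hm stronglyMeasurable_const hs, setIntegral_condExp hm hf hs]
  have := h s hs
  rwa [integral_sub hf.integrableOn (integrable_const c), sub_nonpos] at this

/-- A Lipschitz function of a vector with uniformly bounded second moments has uniformly bounded
second moments. -/
theorem HasBddMoment2.exists_integral_sq_comp_le {Ω : Type*} [MeasurableSpace Ω] {d : ℕ}
    {Pset : Set (ProbabilityMeasure Ω)} {X : Ω → EuclideanSpace ℝ (Fin d)} (hX : Measurable X)
    (hmom : HasBddMoment2 Pset X) {f : EuclideanSpace ℝ (Fin d) → ℝ} {K : ℝ≥0}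
    (hf : LipschitzWith K f) :
    ∃ B : ℝ, ∀ Q ∈ Pset, Integrable (fun ω => f (X ω) ^ 2) (Q : Measure Ω) ∧
      ∫ ω, f (X ω) ^ 2 ∂(Q : Measure Ω) ≤ B := by
  obtain ⟨C, hC⟩ := hmom
  have hfm : Measurable f := hf.continuous.measurable
  have hle : ∀ x, f x ^ 2 ≤ 2 * f 0 ^ 2 + 2 * (K : ℝ) ^ 2 * ‖x‖ ^ 2 := by
    intro x
    have h1 : |f x - f 0| ≤ K * ‖x‖ := by simpa [Real.dist_eq] using hf.dist_le_mul x 0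
    have h2 : (f x - f 0) ^ 2 ≤ (K * ‖x‖) ^ 2 := sq_le_sq' (abs_le.1 h1).1 (abs_le.1 h1).2
    nlinarith [sq_nonneg (f x - 2 * f 0)]
  refine ⟨2 * f 0 ^ 2 + 2 * (K : ℝ) ^ 2 * C, fun Q hQ => ?_⟩
  obtain ⟨hi, hb⟩ := hC Q hQ
  have hdom : Integrable (fun ω => 2 * f 0 ^ 2 + 2 * (K : ℝ) ^ 2 * ‖X ω‖ ^ 2) (Q : Measure Ω) :=
    (integrable_const _).add (hi.const_mul _)
  have hsq : Integrable (fun ω => f (X ω) ^ 2) (Q : Measure Ω) :=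
    hdom.mono' (Measurable.aestronglyMeasurable (by fun_prop)) (ae_of_all _ fun ω => by
      rw [Real.norm_of_nonneg (sq_nonneg _)]; exact hle _)
  refine ⟨hsq, (integral_mono hsq hdom fun ω => hle (X ω)).trans ?_⟩
  rw [integral_add (integrable_const _) (hi.const_mul _),
    integral_const_mul (2 * (K : ℝ) ^ 2)]
  simp only [integral_const, probReal_univ, one_smul]
  gcongr

/-- for independent `X_1, …, X_n` (0-indexed here) with uniformly bounded
second moments, `E_P[φ(X_i) | F_{i-1}] ≤ Ê[φ(X_i)]` `P`-a.s. for every `P ∈ 𝒫` and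
every Lipschitz `φ`.  Here `sigmaF X i.1` is `σ(X_1, …, X_{i-1})`. -/
theorem condexp_le_sublinear_expectation
    {Ω : Type*} [MetricSpace Ω] [CompleteSpace Ω] [TopologicalSpace.SeparableSpace Ω]
    [MeasurableSpace Ω] [BorelSpace Ω]
    {d n : ℕ} (Pset : Set (ProbabilityMeasure Ω))
    (hne : Pset.Nonempty) (hconv : ConvexPM Pset) (hcomp : IsCompact Pset)
    (X : Fin n → Ω → EuclideanSpace ℝ (Fin d))
    (hmeas : ∀ i, Measurable (X i))
    (hmom : ∀ i, HasBddMoment2 Pset (X i))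
    (hindep : IndepUnder Pset X)
    (P : ProbabilityMeasure Ω) (hP : P ∈ Pset)
    (φ : EuclideanSpace ℝ (Fin d) → ℝ) (hφ : ∃ K : ℝ≥0, LipschitzWith K φ)
    (i : Fin n) :
    ∀ᵐ ω ∂(P : Measure Ω),
      ((P : Measure Ω)[fun ω' => φ (X i ω') | sigmaF X i.1]) ω
        ≤ hatE Pset (fun ω' => φ (X i ω')) := by
  obtain ⟨K, hK⟩ := hφ
  have hφm : Measurable φ := hK.continuous.measurable
  obtain ⟨B, hB⟩ := (hmom i).exists_integral_sq_comp_le (hmeas i) hK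
  have hint : ∀ Q ∈ Pset, Integrable (fun ω => φ (X i ω)) (Q : Measure Ω) := fun Q hQ =>
    ((memLp_two_iff_integrable_sq (hφm.comp (hmeas i)).aestronglyMeasurable).2
      (hB Q hQ).1).integrable one_le_two
  have hle : ∀ Q ∈ Pset, ∫ ω, φ (X i ω) ∂(Q : Measure Ω) ≤ (1 + B) / 2 := by
    intro Q hQ
    calc ∫ ω, φ (X i ω) ∂(Q : Measure Ω)
        ≤ ∫ ω, (1 + φ (X i ω) ^ 2) / 2 ∂(Q : Measure Ω) :=
          integral_mono (hint Q hQ) (((integrable_const 1).add (hB Q hQ).1).div_const 2)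
            fun ω => by nlinarith [sq_nonneg (φ (X i ω) - 1)]
      _ = (1 + ∫ ω, φ (X i ω) ^ 2 ∂(Q : Measure Ω)) / 2 := by
          rw [integral_div, integral_add (integrable_const 1) (hB Q hQ).1]
          simp
      _ ≤ (1 + B) / 2 := by
          have := (hB Q hQ).2
          gcongr
  have hhat : ∀ Q ∈ Pset, ∫ ω, φ (X i ω) ∂(Q : Measure Ω) ≤ hatE Pset fun ω => φ (X i ω) :=
    fun Q hQ => integral_le_hatE hle hQ
  obtain ⟨_ | k, hk⟩ := i
  · have hbot : sigmaF X 0 = ⊥ := by simp [sigmaF]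
    simp only [hbot, condExp_bot]
    exact ae_of_all _ fun _ => hhat P hP
  · have hY : Measurable fun ω (j : Fin (k + 1)) => X ⟨j.1, lt_trans j.2 hk⟩ ω :=
      measurable_pi_lambda _ fun j => hmeas _
    have hσ := sigmaF_succ_le_comap hk X
    refine condExp_ae_le_const_of_forall_setIntegral_sub_nonpos (hσ.trans hY.comap_le)
      (hint P hP) fun s hs => ?_
    obtain ⟨A, hA, rfl⟩ := hσ s hs
    exact setIntegral_preimage_nonpos_of_forall_lipschitzWith hY
      ((hφm.comp (hmeas _)).sub_const _) ((hint P hP).sub (integrable_const _))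
      (fun g hg hg1 => hindep.integral_mul_sub_nonpos_of_sq hne hmeas hP hk hg hg1 ⟨K, hK⟩
        hint (fun Q hQ => (hB Q hQ).1) (fun Q hQ => (hB Q hQ).2) hhat) hA
end
end

section
/- Let X : Ω → ℝ^d be continuous with sup_{P ∈ 𝒫} E_P[|X|²] < ∞, and set Θ_X := {θ ∈ ℝ^d : ⟨θ, p⟩ ≤ Ê[⟨p, X⟩] for all p ∈ ℝ^d}. Then Θ_X = {E_P[X] : P ∈ 𝒫}. -/
open MeasureTheory Set
open scoped NNReal ENNReal RealInnerProductSpace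

noncomputable section

variable {Ω : Type*} [MeasurableSpace Ω] [TopologicalSpace Ω]

/-- A continuous function with square integrals uniformly bounded over `S` has an integral that
depends weakly continuously on the measure in `S`. -/
theorem continuousOn_integral_of_integral_sq_le {Ω : Type*} [TopologicalSpace Ω]
    [MeasurableSpace Ω] [OpensMeasurableSpace Ω] {S : Set (ProbabilityMeasure Ω)} {f : Ω → ℝ}
    (hf : Continuous f) {C : ℝ}
    (hint : ∀ P ∈ S, Integrable (fun ω => f ω ^ 2) (P : Measure Ω))
    (hC : ∀ P ∈ S, ∫ ω, f ω ^ 2 ∂(P : Measure Ω) ≤ C) :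
    ContinuousOn (fun P : ProbabilityMeasure Ω => ∫ ω, f ω ∂(P : Measure Ω)) S := by
  let g : ℕ → BoundedContinuousFunction Ω ℝ := fun n =>
    BoundedContinuousFunction.ofNormedAddCommGroup (fun ω => max (-(n : ℝ)) (min (f ω) n))
      (by fun_prop) n (fun ω => by
        have hn : (0 : ℝ) ≤ n := n.cast_nonneg
        rw [Real.norm_eq_abs, abs_le]
        exact ⟨le_max_left _ _, max_le (by linarith) (min_le_right _ _)⟩)
  have hg : ∀ (n : ℕ) ω, g n ω = max (-(n : ℝ)) (min (f ω) n) := fun _ _ => rfl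
  have hfg : ∀ (n : ℕ) ω, (n : ℝ) * |f ω - g n ω| ≤ f ω ^ 2 := by
    intro n ω
    have hn : (0 : ℝ) ≤ n := n.cast_nonneg
    rw [hg]
    rcases le_total (f ω) n with h | h
    · rw [min_eq_left h]
      rcases le_total (-(n : ℝ)) (f ω) with h' | h'
      · rw [max_eq_right h', sub_self, abs_zero, mul_zero]
        positivity
      · rw [max_eq_left h', abs_of_nonpos (by linarith)]
        nlinarith
    · rw [min_eq_right h, max_eq_right (by linarith), abs_of_nonneg (by linarith)]
      nlinarith
  have hlim : TendstoUniformlyOn (fun (n : ℕ) (P : ProbabilityMeasure Ω) =>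
      ∫ ω, g n ω ∂(P : Measure Ω)) (fun P => ∫ ω, f ω ∂(P : Measure Ω)) Filter.atTop S := by
    rw [Metric.tendstoUniformlyOn_iff]
    intro ε hε
    obtain ⟨N, hN⟩ := exists_nat_gt (C / ε)
    filter_upwards [Filter.eventually_ge_atTop (max N 1)] with n hn P hP
    have hnN : (N : ℝ) ≤ n := by exact_mod_cast (le_max_left _ _).trans hn
    have hn0 : (0 : ℝ) < n := by exact_mod_cast (le_max_right _ _).trans hn
    have hfi : Integrable f (P : Measure Ω) :=
      ((memLp_two_iff_integrable_sq hf.measurable.aestronglyMeasurable).2 (hint P hP)).integrable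
        one_le_two
    have hgi : Integrable (g n) (P : Measure Ω) := (g n).integrable _
    rw [Real.dist_eq, ← integral_sub hfi hgi]
    have h1 : (n : ℝ) * |∫ ω, (f ω - g n ω) ∂(P : Measure Ω)| ≤ C :=
      calc (n : ℝ) * |∫ ω, (f ω - g n ω) ∂(P : Measure Ω)|
          ≤ n * ∫ ω, |f ω - g n ω| ∂(P : Measure Ω) := by
            gcongr
            exact abs_integral_le_integral_abs
        _ = ∫ ω, n * |f ω - g n ω| ∂(P : Measure Ω) := (integral_const_mul _ _).symm
        _ ≤ ∫ ω, f ω ^ 2 ∂(P : Measure Ω) :=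
            integral_mono ((hfi.sub hgi).abs.const_mul _) (hint P hP) (hfg n)
        _ ≤ C := hC P hP
    rw [div_lt_iff₀ hε] at hN
    have h2 : (n : ℝ) * |∫ ω, (f ω - g n ω) ∂(P : Measure Ω)| < n * ε := by nlinarith
    exact lt_of_mul_lt_mul_left h2 hn0.le
  exact hlim.continuousOn (Filter.Frequently.of_forall fun n =>
    (ProbabilityMeasure.continuous_integral_boundedContinuousFunction (g n)).continuousOn)

/-- A map with bounded second moments over `Pset` is integrable under each measure in `Pset`. -/
theorem HasBddMoment2.integrable {Ω : Type*} [TopologicalSpace Ω] [MeasurableSpace Ω]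
    [OpensMeasurableSpace Ω] {d : ℕ} {Pset : Set (ProbabilityMeasure Ω)}
    {X : Ω → EuclideanSpace ℝ (Fin d)} (hmom : HasBddMoment2 Pset X) (hX : Continuous X)
    {P : ProbabilityMeasure Ω} (hP : P ∈ Pset) : Integrable X (P : Measure Ω) := by
  obtain ⟨C, hC⟩ := hmom
  exact ((memLp_two_iff_integrable_sq_norm hX.measurable.aestronglyMeasurable).2
    (hC P hP).1).integrable one_le_two

/-- The expectation of a continuous map with bounded second moments over `Pset` depends weakly
continuously on the measure in `Pset`. -/
theorem HasBddMoment2.continuousOn_integral {Ω : Type*} [TopologicalSpace Ω] [MeasurableSpace Ω]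
    [OpensMeasurableSpace Ω] {d : ℕ} {Pset : Set (ProbabilityMeasure Ω)}
    {X : Ω → EuclideanSpace ℝ (Fin d)} (hmom : HasBddMoment2 Pset X) (hX : Continuous X) :
    ContinuousOn (fun P : ProbabilityMeasure Ω => ∫ ω, X ω ∂(P : Measure Ω)) Pset := by
  have hXi : ∀ P ∈ Pset, Integrable X (P : Measure Ω) := fun P hP => hmom.integrable hX hP
  obtain ⟨C, hC⟩ := hmom
  suffices h : ContinuousOn (fun P : ProbabilityMeasure Ω => fun i : Fin d =>
      (∫ ω, X ω ∂(P : Measure Ω)) i) Pset from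
    (PiLp.continuous_toLp 2 _).comp_continuousOn h
  refine continuousOn_pi.2 fun i => ?_
  have hXc : Continuous fun ω => X ω i := (EuclideanSpace.proj (𝕜 := ℝ) i).continuous.comp hX
  have hle : ∀ ω, X ω i ^ 2 ≤ ‖X ω‖ ^ 2 := fun ω => by
    rw [← sq_abs]
    gcongr
    exact PiLp.norm_apply_le (X ω) i
  have hint : ∀ P ∈ Pset, Integrable (fun ω => X ω i ^ 2) (P : Measure Ω) := fun P hP =>
    (hC P hP).1.mono' (hXc.pow 2).measurable.aestronglyMeasurable
      (Filter.Eventually.of_forall fun ω => by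
        rw [Real.norm_of_nonneg (sq_nonneg _)]
        exact hle ω)
  refine (continuousOn_integral_of_integral_sq_le hXc hint fun P hP =>
    (integral_mono (hint P hP) (hC P hP).1 hle).trans (hC P hP).2).congr fun P hP => ?_
  exact ((EuclideanSpace.proj (𝕜 := ℝ) i).integral_comp_comm (hXi P hP)).symm

/-- The expectations of an integrable map over a convex set of measures form a convex set. -/
theorem ConvexPM.convex_image_integral {Ω : Type*} [MeasurableSpace Ω]
    {E : Type*} [NormedAddCommGroup E] [NormedSpace ℝ E] {Pset : Set (ProbabilityMeasure Ω)}
    (hconv : ConvexPM Pset) {X : Ω → E} (hX : ∀ P ∈ Pset, Integrable X (P : Measure Ω)) :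
    Convex ℝ ((fun P : ProbabilityMeasure Ω => ∫ ω, X ω ∂(P : Measure Ω)) '' Pset) := by
  rintro _ ⟨P, hP, rfl⟩ _ ⟨Q, hQ, rfl⟩ a b ha hb hab
  lift a to ℝ≥0 using ha
  lift b to ℝ≥0 using hb
  have hab' : a + b = 1 := by exact_mod_cast hab
  obtain ⟨R, hR, hRe⟩ := hconv P hP Q hQ a (hab' ▸ le_self_add)
  have hb' : 1 - a = b := by rw [← hab', add_tsub_cancel_left]
  refine ⟨R, hR, ?_⟩
  simp only
  rw [hRe, hb', integral_add_measure ((hX P hP).smul_measure ENNReal.coe_ne_top)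
    ((hX Q hQ).smul_measure ENNReal.coe_ne_top), integral_smul_measure, integral_smul_measure]
  rfl

/-- `Θ_X = {E_P[X] : P ∈ 𝒫}` for a continuous `X` with uniformly bounded
second moments. -/
theorem thetaSet_eq_expectations
    {Ω : Type*} [MetricSpace Ω] [CompleteSpace Ω] [TopologicalSpace.SeparableSpace Ω]
    [MeasurableSpace Ω] [BorelSpace Ω]
    {d : ℕ} (Pset : Set (ProbabilityMeasure Ω))
    (hne : Pset.Nonempty) (hconv : ConvexPM Pset) (hcomp : IsCompact Pset)
    (X : Ω → EuclideanSpace ℝ (Fin d)) (hX : Continuous X)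
    (hmom : HasBddMoment2 Pset X) :
    ThetaSet Pset X
      = {θ | ∃ P ∈ Pset, θ = ∫ ω, X ω ∂((P : ProbabilityMeasure Ω) : Measure Ω)} := by
  have hXi : ∀ P ∈ Pset, Integrable X (P : Measure Ω) := fun P hP => hmom.integrable hX hP
  have hK := hcomp.image_of_continuousOn (hmom.continuousOn_integral hX)
  have hinner : ∀ (p : EuclideanSpace ℝ (Fin d)), ∀ P ∈ Pset,
      ∫ ω, ⟪p, X ω⟫ ∂((P : ProbabilityMeasure Ω) : Measure Ω)
        = ⟪p, ∫ ω, X ω ∂(P : Measure Ω)⟫ := fun p P hP => integral_inner (hXi P hP) p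
  ext θ
  constructor
  · intro hθ
    by_contra hcon
    obtain ⟨f, u, hfu, huθ⟩ := geometric_hahn_banach_closed_point
      (hconv.convex_image_integral hXi) hK.isClosed
      (x := θ) (by rintro ⟨P, hP, h⟩; exact hcon ⟨P, hP, h.symm⟩)
    set p := (InnerProductSpace.toDual ℝ (EuclideanSpace ℝ (Fin d))).symm f
    have hfp : ∀ x, ⟪p, x⟫ = f x := fun x => InnerProductSpace.toDual_symm_apply
    have : Nonempty Pset := hne.to_subtype
    have hle : hatE Pset (fun ω => ⟪p, X ω⟫) ≤ u := ciSup_le fun P => by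
      rw [hinner p P P.2, hfp]
      exact (hfu _ ⟨P, P.2, rfl⟩).le
    have hθp := hθ p
    rw [real_inner_comm, hfp] at hθp
    linarith
  · rintro ⟨P, hP, rfl⟩ p
    rw [real_inner_comm, ← hinner p P hP]
    refine le_ciSup (f := fun P : Pset =>
      ∫ ω, ⟪p, X ω⟫ ∂((P : ProbabilityMeasure Ω) : Measure Ω)) ?_ ⟨P, hP⟩
    refine (hK.image (f := fun x => ⟪p, x⟫) (by fun_prop)).bddAbove.mono ?_
    rintro _ ⟨Q, rfl⟩
    exact ⟨_, ⟨Q, Q.2, rfl⟩, (hinner p Q Q.2).symm⟩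
end
end
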